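/- Let U be a finite subset of ℝ contained in a proper symmetric generalized arithmetic progression P of rank r. Then there exists a proper symmetric GAP Q containing U such that rank(Q) ≤ r, |Q| ≤ O_r(1)·|P|, and U spans Q, i.e., the image of U under the coordinate map of Q has full rank in ℝ^{rank(Q)}. -/

import Mathlib

open Finset

/-- A symmetric generalized arithmetic progression in `ℝ`. -/
structure SymGAP where
  rank : ℕ
  g : Fin rank → ℝ
  K : Fin rank → ℕ

namespace SymGAP

/-- The integer box of coordinates. -/
def box (Q : SymGAP) : Set (Fin Q.rank → ℤ) := {k | ∀ i, |k i| ≤ (Q.K i : ℤ)}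

/-- The coordinate map of `Q`. -/
def Φ (Q : SymGAP) (k : Fin Q.rank → ℤ) : ℝ := ∑ i, (k i : ℝ) * Q.g i

/-- The set of elements of `Q`. -/
def carrier (Q : SymGAP) : Set ℝ := Q.Φ '' Q.box

/-- `Q` is proper if its coordinate map is injective on the box. -/
def Proper (Q : SymGAP) : Prop := Set.InjOn Q.Φ Q.box

end SymGAP


lemma quot_norm {Λ : Type} [AddCommGroup Λ] (N : Λ → ℝ)
    (hadd : ∀ x y, N (x + y) ≤ N x + N y)
    (hsmul : ∀ (k : ℤ) x, N (k • x) = |(k : ℝ)| * N x)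
    (ε : ℝ) (hε : 0 < ε) (hdisc : ∀ x, x ≠ 0 → ε ≤ N x)
    (b : Λ) (hb : ∀ y, y ≠ 0 → N b ≤ 5 / 4 * N y) :
    ∃ N' : (Λ ⧸ (Submodule.span ℤ {b})) → ℝ,
      (∀ x y, N' (x + y) ≤ N' x + N' y) ∧
      (∀ (k : ℤ) x, N' (k • x) = |(k : ℝ)| * N' x) ∧
      (∀ x, N' (Submodule.Quotient.mk x) ≤ N x) ∧
      (∀ q, q ≠ 0 → ∃ x, Submodule.Quotient.mk x = q ∧ N x ≤ 4 * N' q) := by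
  have h0 : N 0 = 0 := by simpa using hsmul 0 0
  have hnn : ∀ x, 0 ≤ N x := by
    intro x
    by_cases hx : x = 0
    · simp [hx, h0]
    · exact hε.le.trans (hdisc x hx)
  set mk : Λ → (Λ ⧸ (Submodule.span ℤ {b})) := fun x => Submodule.Quotient.mk x with hmk
  have mk_add : ∀ x y, mk (x + y) = mk x + mk y := fun x y => rfl
  have mk_smul : ∀ (k : ℤ) y, mk (k • y) = k • mk y := fun x y => rfl
  let S : (Λ ⧸ (Submodule.span ℤ {b})) → Set ℝ := fun q =>
    {t | ∃ n : ℤ, n ≠ 0 ∧ ∃ y, mk y = n • q ∧ t = N y / |(n : ℝ)|}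
  have hbdd : ∀ q, BddBelow (S q) := by
    intro q
    refine ⟨0, ?_⟩
    rintro t ⟨n, hn, y, hy, rfl⟩
    exact div_nonneg (hnn _) (abs_nonneg _)
  have hne : ∀ q, (S q).Nonempty := by
    intro q
    obtain ⟨x, rfl⟩ := Submodule.Quotient.mk_surjective _ q
    exact ⟨_, 1, one_ne_zero, x, by simp [hmk], rfl⟩
  have hle : ∀ q (n : ℤ) y, n ≠ 0 → mk y = n • q → |(n : ℝ)| * sInf (S q) ≤ N y := by
    intro q n y hn hy
    have h1 : sInf (S q) ≤ N y / |(n : ℝ)| := csInf_le (hbdd q) ⟨n, hn, y, hy, rfl⟩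
    have h2 : 0 < |(n : ℝ)| := abs_pos.mpr (by exact_mod_cast hn)
    rw [le_div_iff₀ h2] at h1
    linarith
  have happ : ∀ q (δ : ℝ), 0 < δ → ∃ (n : ℤ) (y : Λ), n ≠ 0 ∧ mk y = n • q ∧
      N y ≤ |(n : ℝ)| * (sInf (S q) + δ) := by
    intro q δ hδ
    obtain ⟨t, ⟨n, hn, y, hy, rfl⟩, ht⟩ := exists_lt_of_csInf_lt (hne q) (lt_add_of_pos_right (sInf (S q)) hδ)
    refine ⟨n, y, hn, hy, ?_⟩
    have h2 : 0 < |(n : ℝ)| := abs_pos.mpr (by exact_mod_cast hn)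
    rw [div_lt_iff₀ h2] at ht
    linarith
  have hnn' : ∀ q, 0 ≤ sInf (S q) := by
    intro q
    apply Real.sInf_nonneg
    rintro t ⟨n, hn, y, hy, rfl⟩
    exact div_nonneg (hnn _) (abs_nonneg _)
  refine ⟨fun q => sInf (S q), ?_, ?_, ?_, ?_⟩
  · intro p q
    refine le_of_forall_pos_le_add fun δ hδ => ?_
    obtain ⟨n, y, hn, hy, hN⟩ := happ p (δ / 2) (by positivity)
    obtain ⟨m, z, hm, hz, hM⟩ := happ q (δ / 2) (by positivity)
    have h1 := hle (p + q) (n * m) (m • y + n • z) (mul_ne_zero hn hm) (by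
      rw [mk_add, mk_smul, mk_smul, hy, hz, smul_add, smul_smul, smul_smul, mul_comm m n])
    have h2 := hadd (m • y) (n • z)
    rw [hsmul, hsmul] at h2
    have hn' : 0 < |(n : ℝ)| := abs_pos.mpr (by exact_mod_cast hn)
    have hm' : 0 < |(m : ℝ)| := abs_pos.mpr (by exact_mod_cast hm)
    push_cast at h1
    rw [abs_mul] at h1
    have h3 := mul_le_mul_of_nonneg_left hN hm'.le
    have h4 := mul_le_mul_of_nonneg_left hM hn'.le
    refine le_of_mul_le_mul_left ?_ (mul_pos hn' hm')
    nlinarith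
  · intro k q
    apply le_antisymm
    · refine le_of_forall_pos_le_add fun δ hδ => ?_
      obtain ⟨n, y, hn, hy, hN⟩ := happ q (δ / (|(k : ℝ)| + 1)) (by positivity)
      have h1 := hle (k • q) n (k • y) hn (by rw [mk_smul, hy, smul_comm])
      rw [hsmul] at h1
      have hn' : 0 < |(n : ℝ)| := abs_pos.mpr (by exact_mod_cast hn)
      have h3 := mul_le_mul_of_nonneg_left hN (abs_nonneg (k : ℝ))
      have h4 : |(k : ℝ)| * (δ / (|(k : ℝ)| + 1)) ≤ δ := by
        rw [mul_div_assoc', div_le_iff₀ (by positivity)]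
        nlinarith
      refine le_of_mul_le_mul_left ?_ hn'
      nlinarith
    · by_cases hk : k = 0
      · simp only [hk]; simpa using hnn' _
      refine le_csInf (hne _) ?_
      rintro t ⟨n, hn, y, hy, rfl⟩
      have h1 := hle q (n * k) y (mul_ne_zero hn hk) (by rw [hy, smul_smul])
      have hn' : 0 < |(n : ℝ)| := abs_pos.mpr (by exact_mod_cast hn)
      rw [le_div_iff₀ hn']
      push_cast at h1
      rw [abs_mul] at h1
      linarith
  · intro x
    have := hle (mk x) 1 x one_ne_zero (by simp)
    simpa using this
  · intro q hq
    obtain ⟨n, y, hn, hy, hN⟩ := happ q (ε / 8) (by positivity)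
    obtain ⟨x, hx⟩ := Submodule.Quotient.mk_surjective _ q
    have hn' : 0 < |(n : ℝ)| := abs_pos.mpr (by exact_mod_cast hn)
    have h1 : mk y = mk (n • x) := by rw [mk_smul, hy, ← hx]
    have h2 := (Submodule.Quotient.eq _).1 h1
    obtain ⟨k, hk⟩ := Submodule.mem_span_singleton.1 h2
    set t : ℤ := round ((k : ℝ) / n) with ht
    have h3 : |(k : ℝ) / n - t| ≤ 1 / 2 := abs_sub_round _
    have h4 : |((n * t - k : ℤ) : ℝ)| ≤ |(n : ℝ)| / 2 := by
      have : ((n * t - k : ℤ) : ℝ) = - (n * ((k : ℝ) / n - t)) := by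
        push_cast
        have : (n : ℝ) ≠ 0 := by exact_mod_cast hn
        field_simp
        ring
      rw [this, abs_neg, abs_mul]
      nlinarith
    have hq' : mk (x + t • b) = q := by
      rw [mk_add, ← hx]
      have : mk (t • b) = 0 := (Submodule.Quotient.mk_eq_zero _).2
        (Submodule.smul_mem _ _ (Submodule.mem_span_singleton_self b))
      rw [this, add_zero]
    have hz : x + t • b ≠ 0 := by
      intro h
      rw [h] at hq'
      exact hq hq'.symm
    have h5 : n • (x + t • b) = y + (n * t - k) • b := by
      rw [sub_smul, hk, smul_add, smul_smul]
      abel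
    have h6 := hadd y ((n * t - k) • b)
    rw [← h5, hsmul, hsmul] at h6
    have h7 := mul_le_mul_of_nonneg_right h4 (hnn b)
    have h8 : N (x + t • b) ≤ sInf (S q) + ε / 8 + N b / 2 := by
      refine le_of_mul_le_mul_left ?_ hn'
      nlinarith
    refine ⟨x + t • b, hq', ?_⟩
    have h9 := hb _ hz
    have h10 := hdisc _ hz
    show _ ≤ 4 * sInf (S q)
    linarith

lemma reduced_basis (n : ℕ) : ∃ c : ℝ, 1 ≤ c ∧ ∀ (Λ : Type) [AddCommGroup Λ] [Module.Finite ℤ Λ],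
    Module.finrank ℤ Λ ≤ n → ∀ (N : Λ → ℝ),
    (∀ x y, N (x + y) ≤ N x + N y) →
    (∀ (k : ℤ) x, N (k • x) = |(k : ℝ)| * N x) →
    ∀ (ε : ℝ), 0 < ε → (∀ x, x ≠ 0 → ε ≤ N x) →
    ∃ d ≤ n, ∃ b : Fin d → Λ, (∀ i, b i ≠ 0) ∧ (∀ x, ∃ k : Fin d → ℤ, x = ∑ i, k i • b i) ∧
      ∀ k : Fin d → ℤ, ∀ i, |(k i : ℝ)| * N (b i) ≤ c * N (∑ j, k j • b j) := by
  induction n with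
  | zero =>
    refine ⟨1, le_rfl, ?_⟩
    intro Λ _ _ hr N hadd hsmul ε hε hdisc
    have hx : ∀ x : Λ, x = 0 := by
      intro x
      by_contra hx
      have : LinearIndependent ℤ (fun _ : Fin 1 => x) := by
        rw [Fintype.linearIndependent_iff]
        intro g hg i
        simp only [Finset.univ_unique, Finset.sum_singleton] at hg
        have h1 := hsmul (g default) x
        have h0 : N 0 = 0 := by simpa using hsmul 0 0
        rw [hg, h0] at h1
        have h2 := hdisc x hx
        have : |((g default : ℤ) : ℝ)| = 0 := by
          rcases mul_eq_zero.1 h1.symm with h | h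
          · exact h
          · linarith
        have := abs_eq_zero.1 this
        rw [Subsingleton.elim i default]
        exact_mod_cast this
      have := this.fintype_card_le_finrank
      simp at this
      omega
    exact ⟨0, le_rfl, fun _ => 0, fun i => i.elim0, fun x => ⟨0, by simp [hx x]⟩, fun k i => i.elim0⟩
  | succ n ih =>
    obtain ⟨c, hc, ih⟩ := ih
    refine ⟨1 + 4 * (n + 1) * c, by nlinarith [(Nat.cast_nonneg n : (0 : ℝ) ≤ n)], ?_⟩
    intro Λ _ _ hr N hadd hsmul ε hε hdisc
    have h0 : N 0 = 0 := by simpa using hsmul 0 0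
    have hnn : ∀ x, 0 ≤ N x := by
      intro x
      by_cases hx : x = 0
      · simp [hx, h0]
      · exact hε.le.trans (hdisc x hx)
    by_cases htriv : ∀ x : Λ, x = 0
    · exact ⟨0, by omega, fun _ => 0, fun i => i.elim0, fun x => ⟨0, by simp [htriv x]⟩,
        fun k i => i.elim0⟩
    push Not at htriv
    obtain ⟨x0, hx0⟩ := htriv
    -- almost shortest vector
    obtain ⟨b, hb0, hb⟩ : ∃ b : Λ, b ≠ 0 ∧ ∀ y, y ≠ 0 → N b ≤ 5 / 4 * N y := by
      set T : Set ℝ := {t | ∃ x, x ≠ 0 ∧ t = N x} with hT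
      have hTb : BddBelow T := ⟨ε, by rintro t ⟨x, hx, rfl⟩; exact hdisc x hx⟩
      have hTn : T.Nonempty := ⟨_, x0, hx0, rfl⟩
      have hTε : ε ≤ sInf T := le_csInf hTn (by rintro t ⟨x, hx, rfl⟩; exact hdisc x hx)
      obtain ⟨t, ⟨b, hb, rfl⟩, ht⟩ := exists_lt_of_csInf_lt hTn
        (show sInf T < 5 / 4 * sInf T by linarith)
      refine ⟨b, hb, fun y hy => ?_⟩
      have : sInf T ≤ N y := csInf_le hTb ⟨y, hy, rfl⟩
      linarith
    obtain ⟨N', hadd', hsmul', hle', hlift⟩ := quot_norm N hadd hsmul ε hε hdisc b hb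
    have hli : LinearIndependent ℤ (fun _ : Fin 1 => b) := by
      rw [Fintype.linearIndependent_iff]
      intro g hg i
      simp only [Finset.univ_unique, Finset.sum_singleton] at hg
      have h1 := hsmul (g default) b
      rw [hg, h0] at h1
      have h2 := hdisc b hb0
      have : |((g default : ℤ) : ℝ)| = 0 := by
        rcases mul_eq_zero.1 h1.symm with h | h
        · exact h
        · linarith
      have := abs_eq_zero.1 this
      rw [Subsingleton.elim i default]
      exact_mod_cast this
    have hr1 : Module.finrank ℤ (Submodule.span ℤ {b}) = 1 := by
      have := finrank_span_eq_card hli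
      rw [Set.range_const] at this
      simpa using this
    have hr2 : Module.finrank ℤ (Λ ⧸ Submodule.span ℤ {b}) ≤ n := by
      have := Submodule.finrank_quotient_add_finrank (Submodule.span ℤ {b})
      omega
    obtain ⟨d, hd, β, hβ0, hβs, hβ⟩ := ih (Λ ⧸ Submodule.span ℤ {b}) hr2 N' hadd' hsmul' (ε / 4)
      (by positivity) (by
        intro q hq
        obtain ⟨x, hx, hN⟩ := hlift q hq
        have : x ≠ 0 := by
          rintro rfl
          exact hq hx.symm
        have := hdisc x this
        linarith)
    choose l hl hlN using fun i => hlift (β i) (hβ0 i)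
    have hsum : ∀ k : Fin d → ℤ, (Submodule.Quotient.mk (∑ i, k i • l i) :
        Λ ⧸ Submodule.span ℤ {b}) = ∑ i, k i • β i := by
      intro k
      have : (Submodule.span ℤ {b}).mkQ (∑ i, k i • l i) = ∑ i, k i • β i := by
        rw [map_sum]
        refine Finset.sum_congr rfl fun i _ => ?_
        rw [map_smul, ← hl i]
        rfl
      exact this
    refine ⟨d + 1, by omega, Fin.cons b l, ?_, ?_, ?_⟩
    · intro i
      refine Fin.cases ?_ (fun i => ?_) i
      · exact hb0
      · simp only [Fin.cons_succ]
        intro h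
        have := hl i
        rw [h] at this
        exact hβ0 i this.symm
    · intro x
      obtain ⟨k, hk⟩ := hβs (Submodule.Quotient.mk x)
      rw [← hsum, Submodule.Quotient.eq] at hk
      obtain ⟨a, ha⟩ := Submodule.mem_span_singleton.1 hk
      refine ⟨Fin.cons a k, ?_⟩
      rw [Fin.sum_univ_succ]
      simp only [Fin.cons_zero, Fin.cons_succ]
      rw [ha]; abel
    · intro k
      rw [Fin.sum_univ_succ]
      simp only [Fin.cons_zero, Fin.cons_succ]
      set x := k 0 • b + ∑ j : Fin d, k j.succ • l j with hx
      have hmkx : (Submodule.Quotient.mk x : Λ ⧸ Submodule.span ℤ {b}) =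
          ∑ j, k j.succ • β j := by
        rw [← hsum (fun j => k j.succ), Submodule.Quotient.eq]
        rw [hx, add_sub_cancel_right]
        exact Submodule.smul_mem _ _ (Submodule.mem_span_singleton_self b)
      have hN'x := hle' x
      rw [hmkx] at hN'x
      have key : ∀ j : Fin d, |(k j.succ : ℝ)| * N (l j) ≤ 4 * c * N x := by
        intro j
        have h1 := hβ (fun j => k j.succ) j
        have h2 := mul_le_mul_of_nonneg_left (hlN j) (abs_nonneg (k j.succ : ℝ))
        have h3 := mul_le_mul_of_nonneg_left hN'x (by linarith : (0 : ℝ) ≤ c)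
        linarith
      have hsumN : ∀ (s : Finset (Fin d)), N (∑ j ∈ s, k j.succ • l j) ≤
          ∑ j ∈ s, |(k j.succ : ℝ)| * N (l j) := by
        intro s
        induction s using Finset.cons_induction with
        | empty => simp [h0]
        | cons a s ha ih =>
          rw [Finset.sum_cons, Finset.sum_cons]
          refine (hadd _ _).trans ?_
          rw [hsmul]
          linarith
      have hdn : (d : ℝ) ≤ n := by exact_mod_cast hd
      intro i
      refine Fin.cases ?_ (fun i => ?_) i
      · simp only [Fin.cons_zero]
        have e : k 0 • b = x + (-1 : ℤ) • ∑ j : Fin d, k j.succ • l j := by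
          rw [hx]; simp
        rw [← hsmul, e]
        refine (hadd _ _).trans ?_
        rw [hsmul]
        have h1 := hsumN Finset.univ
        have h2 : ∑ j : Fin d, |(k j.succ : ℝ)| * N (l j) ≤ ∑ j : Fin d, 4 * c * N x :=
          Finset.sum_le_sum fun j _ => key j
        simp only [Finset.sum_const, Finset.card_univ, Fintype.card_fin, nsmul_eq_mul] at h2
        have h3 : (d : ℝ) * (4 * c * N x) ≤ n * (4 * c * N x) :=
          mul_le_mul_of_nonneg_right hdn (mul_nonneg (by linarith) (hnn x))
        have h4 : 0 ≤ c * N x := mul_nonneg (by linarith) (hnn x)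
        have : |((-1 : ℤ) : ℝ)| = 1 := by simp
        rw [this]
        nlinarith
      · simp only [Fin.cons_succ]
        refine (key i).trans ?_
        have h4 : 0 ≤ c * N x := mul_nonneg (by linarith) (hnn x)
        have h5 : 0 ≤ (n : ℝ) * (c * N x) := mul_nonneg (Nat.cast_nonneg n) h4
        nlinarith [hnn x]

lemma count_lemma (n : ℕ) : ∃ D : ℝ, 1 ≤ D ∧
    ∀ (Λ : Type) [AddCommGroup Λ] [Module.Finite ℤ Λ],
    Module.finrank ℤ Λ ≤ n → ∀ (N : Λ → ℝ),
    (∀ x y, N (x + y) ≤ N x + N y) →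
    (∀ (k : ℤ) x, N (k • x) = |(k : ℝ)| * N x) →
    ∀ (ε : ℝ), 0 < ε → (∀ x, x ≠ 0 → ε ≤ N x) →
    ∀ (R : ℝ), 0 < R → ∀ M : ℕ,
    (∀ T : Finset Λ, (∀ y ∈ T, N y ≤ R) → T.card ≤ M) →
    ∃ d ≤ n, ∃ b : Fin d → Λ, ∃ K : Fin d → ℕ, (∀ i, 1 ≤ K i) ∧
      (∀ y, N y ≤ 2 * R → ∃ k : Fin d → ℤ, (∀ i, |k i| ≤ (K i : ℤ)) ∧ y = ∑ i, k i • b i) ∧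
      ∏ i, (2 * (K i : ℝ) + 1) ≤ D * M := by
  classical
  obtain ⟨c, hc, H⟩ := reduced_basis n
  have hn0 : (0 : ℝ) ≤ n := Nat.cast_nonneg n
  have hE : 1 ≤ 4 * c * (n + 1) + 3 := by nlinarith
  refine ⟨(4 * c * (n + 1) + 3) ^ n, one_le_pow₀ hE, ?_⟩
  intro Λ _ _ hr N hadd hsmul ε hε hdisc R hR M hM
  obtain ⟨d, hd, b, hb0, hbs, hb⟩ := H Λ hr N hadd hsmul ε hε hdisc
  have h0 : N 0 = 0 := by simpa using hsmul 0 0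
  have hbpos : ∀ i, 0 < N (b i) := fun i => hε.trans_le (hdisc _ (hb0 i))
  have hdn : (d : ℝ) ≤ n := by exact_mod_cast hd
  let s : Fin d → ℕ := fun i => ⌊R / ((n + 1) * N (b i))⌋₊
  refine ⟨d, hd, b, fun i => ⌊2 * R * c / N (b i)⌋₊ + 1, fun i => Nat.le_add_left 1 _, ?_, ?_⟩
  · intro y hy
    obtain ⟨k, rfl⟩ := hbs y
    refine ⟨k, fun i => ?_, rfl⟩
    have h1 := hb k i
    have h2 : |(k i : ℝ)| ≤ 2 * R * c / N (b i) := by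
      rw [le_div_iff₀ (hbpos i)]
      nlinarith
    have h3 := Nat.lt_floor_add_one (2 * R * c / N (b i))
    have h4 : ((|k i| : ℤ) : ℝ) ≤ ((⌊2 * R * c / N (b i)⌋₊ + 1 : ℕ) : ℝ) := by
      push_cast
      linarith
    exact_mod_cast h4
  · have hinj : Set.InjOn (fun k : Fin d → ℤ => ∑ i, k i • b i) Set.univ := by
      intro k _ k' _ h
      have h1 := hb (k - k')
      have h2 : ∑ j, (k - k') j • b j = 0 := by
        simp only [Pi.sub_apply, sub_smul, Finset.sum_sub_distrib]
        exact sub_eq_zero.2 h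
      rw [h2, h0, mul_zero] at h1
      funext i
      have h3 := h1 i
      have h4 : |((k - k') i : ℝ)| = 0 := by
        by_contra hne
        have : 0 < |((k - k') i : ℝ)| := lt_of_le_of_ne (abs_nonneg _) (Ne.symm hne)
        have := mul_pos this (hbpos i)
        linarith
      have h5 := abs_eq_zero.1 h4
      have h6 : (k - k') i = 0 := by exact_mod_cast h5
      simpa [sub_eq_zero] using h6
    have hsumN : ∀ (k : Fin d → ℤ) (t : Finset (Fin d)), N (∑ j ∈ t, k j • b j) ≤
        ∑ j ∈ t, |(k j : ℝ)| * N (b j) := by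
      intro k t
      induction t using Finset.cons_induction with
      | empty => simp [h0]
      | cons a s ha ih =>
        rw [Finset.sum_cons, Finset.sum_cons]
        refine (hadd _ _).trans ?_
        rw [hsmul]
        linarith
    let B : Finset (Fin d → ℤ) := Fintype.piFinset fun i => Finset.Icc (-(s i : ℤ)) (s i)
    have hBcard : B.card = ∏ i, (2 * s i + 1) := by
      rw [Fintype.card_piFinset]
      refine Finset.prod_congr rfl fun i _ => ?_
      rw [Int.card_Icc]
      omega
    have hcard := hM (B.image fun k : Fin d → ℤ => ∑ i, k i • b i) (by
      intro y hy
      obtain ⟨k, hk, rfl⟩ := Finset.mem_image.1 hy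
      refine (hsumN k Finset.univ).trans ?_
      have h1 : ∀ j ∈ Finset.univ, |(k j : ℝ)| * N (b j) ≤ R / (n + 1) := by
        intro j _
        have h2 := Fintype.mem_piFinset.1 hk j
        rw [Finset.mem_Icc, ← abs_le] at h2
        have h3 : |(k j : ℝ)| ≤ (s j : ℝ) := by exact_mod_cast h2
        have h4 : (s j : ℝ) ≤ R / ((n + 1) * N (b j)) :=
          Nat.floor_le (by have := hbpos j; positivity)
        have h5 := mul_le_mul_of_nonneg_right (h3.trans h4) (hbpos j).le
        refine h5.trans (le_of_eq ?_)
        have := (hbpos j).ne'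
        field_simp
      refine (Finset.sum_le_sum h1).trans ?_
      simp only [Finset.sum_const, Finset.card_univ, Fintype.card_fin, nsmul_eq_mul]
      rw [mul_div_assoc', div_le_iff₀ (by positivity)]
      nlinarith)
    rw [Finset.card_image_of_injOn (hinj.mono (Set.subset_univ _)), hBcard] at hcard
    have hcard' : ∏ i, (2 * (s i : ℝ) + 1) ≤ M := by exact_mod_cast hcard
    have h1 : ∏ i, (2 * ((⌊2 * R * c / N (b i)⌋₊ + 1 : ℕ) : ℝ) + 1) ≤
        ∏ i, ((4 * c * (n + 1) + 3) * (2 * (s i : ℝ) + 1)) := by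
      refine Finset.prod_le_prod (fun i _ => by positivity) fun i _ => ?_
      have hp := hbpos i
      have h2 : (⌊2 * R * c / N (b i)⌋₊ : ℝ) ≤ 2 * R * c / N (b i) :=
        Nat.floor_le (by positivity)
      have h3 : R / ((n + 1) * N (b i)) < s i + 1 := Nat.lt_floor_add_one _
      have h4 : 2 * R * c / N (b i) = 2 * c * (n + 1) * (R / ((n + 1) * N (b i))) := by
        field_simp
      have h5 : 2 * c * (n + 1) * (R / ((n + 1) * N (b i))) ≤ 2 * c * (n + 1) * (s i + 1) :=
        mul_le_mul_of_nonneg_left h3.le (by positivity)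
      push_cast
      have h6 : (0 : ℝ) ≤ s i := Nat.cast_nonneg _
      have h7 : 0 ≤ c * (n + 1) * s i := by positivity
      nlinarith
    refine h1.trans ?_
    rw [Finset.prod_mul_distrib]
    simp only [Finset.prod_const, Finset.card_univ, Fintype.card_fin]
    exact mul_le_mul (pow_le_pow_right₀ hE hd) hcard'
      (Finset.prod_nonneg fun i _ => by positivity) (by positivity)

lemma lattice_lemma (r : ℕ) : ∃ D : ℝ, 1 ≤ D ∧
    ∀ (K : Fin (r + 1) → ℕ), (∀ i, 1 ≤ K i) →
    ∀ (Λ : Submodule ℤ (Fin (r + 1) → ℤ)) (i0 : Fin (r + 1)),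
    (∀ x ∈ Λ, (∀ i, i ≠ i0 → x i = 0) → x = 0) →
    ∀ (R : ℝ), 0 < R → ∀ M : ℕ,
    (∀ T : Finset (Fin (r + 1) → ℤ),
      (∀ y ∈ T, y ∈ Λ ∧ ∀ i, |(y i : ℝ)| ≤ R * K i) → T.card ≤ M) →
    ∃ d ≤ r, ∃ b : Fin d → (Fin (r + 1) → ℤ), ∃ K' : Fin d → ℕ, (∀ i, 1 ≤ K' i) ∧
      (∀ y ∈ Λ, (∀ i, |(y i : ℝ)| ≤ 2 * R * K i) →
        ∃ k : Fin d → ℤ, (∀ i, |k i| ≤ (K' i : ℤ)) ∧ y = ∑ i, k i • b i) ∧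
      ∏ i, (2 * (K' i : ℝ) + 1) ≤ D * M := by
  classical
  obtain ⟨D, hD, H⟩ := count_lemma r
  refine ⟨D, hD, ?_⟩
  intro K hK Λ i0 hΛ R hR M hM
  have hK' : ∀ i, (1 : ℝ) ≤ K i := fun i => by exact_mod_cast hK i
  have hrank : Module.finrank ℤ Λ ≤ r := by
    let f : Λ →ₗ[ℤ] (Fin r → ℤ) :=
      (LinearMap.funLeft ℤ ℤ (fun j : Fin r => i0.succAbove j)).comp Λ.subtype
    have hf : Function.Injective f := by
      rw [injective_iff_map_eq_zero]
      intro x hx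
      apply Subtype.ext
      apply hΛ x.1 x.2
      intro i hi
      obtain ⟨j, rfl⟩ := Fin.exists_succAbove_eq hi
      exact congrFun hx j
    have := LinearMap.finrank_le_finrank_of_injective hf
    simpa using this
  let N : Λ → ℝ := fun x => ‖fun i => (x.1 i : ℝ) / K i‖
  have hNle : ∀ (x : Λ) (t : ℝ), 0 ≤ t → (N x ≤ t ↔ ∀ i, |(x.1 i : ℝ)| ≤ t * K i) := by
    intro x t ht
    simp only [N]
    rw [pi_norm_le_iff_of_nonneg ht]
    refine forall_congr' fun i => ?_
    have : (0 : ℝ) < K i := by linarith [hK' i]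
    rw [Real.norm_eq_abs, abs_div, abs_of_pos this, div_le_iff₀ this]
  obtain ⟨d, hd, b, K', hK1, hcov, hprod⟩ := H Λ hrank N
    (by
      intro x y
      simp only [N]
      refine le_trans (le_of_eq ?_) (norm_add_le _ _)
      congr 1
      funext i
      simp [add_div])
    (by
      intro k x
      simp only [N]
      rw [← Real.norm_eq_abs, ← norm_smul]
      congr 1
      funext i
      simp [mul_div_assoc])
    (1 / (∑ i, (K i : ℝ))) (by
      have : 0 < ∑ i, (K i : ℝ) := Finset.sum_pos (fun i _ => by linarith [hK' i]) ⟨i0, Finset.mem_univ _⟩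
      positivity)
    (by
      intro x hx
      have : ∃ i, x.1 i ≠ 0 := by
        by_contra h
        push Not at h
        exact hx (Subtype.ext (funext h))
      obtain ⟨i, hi⟩ := this
      have h1 : ‖(x.1 i : ℝ) / K i‖ ≤ N x := norm_le_pi_norm (fun i => (x.1 i : ℝ) / K i) i
      refine le_trans ?_ h1
      have h2 : (0 : ℝ) < K i := by linarith [hK' i]
      rw [Real.norm_eq_abs, abs_div, abs_of_pos h2]
      have h3 : (1 : ℝ) ≤ |(x.1 i : ℝ)| := by exact_mod_cast Int.one_le_abs hi
      have h4 : (K i : ℝ) ≤ ∑ i, (K i : ℝ) :=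
        Finset.single_le_sum (f := fun i => (K i : ℝ)) (fun i _ => Nat.cast_nonneg _) (Finset.mem_univ i)
      exact div_le_div₀ (by positivity) h3 h2 h4)
    R hR M (by
      intro T hT
      rw [← Finset.card_image_of_injective T Subtype.val_injective]
      apply hM
      intro y hy
      obtain ⟨x, hx, rfl⟩ := Finset.mem_image.1 hy
      exact ⟨x.2, (hNle x R hR.le).1 (hT x hx)⟩)
  refine ⟨d, hd, fun i => (b i).1, K', hK1, ?_, hprod⟩
  intro y hy hyb
  obtain ⟨k, hk, e⟩ := hcov ⟨y, hy⟩ ((hNle _ _ (by positivity)).2 hyb)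
  refine ⟨k, hk, ?_⟩
  have := congrArg Subtype.val e
  simpa using this

lemma card_box_le {r : ℕ} (K : Fin r → ℕ) (T : Finset (Fin r → ℤ))
    (hT : ∀ y ∈ T, ∀ i, |y i| ≤ (K i : ℤ)) : T.card ≤ ∏ i, (2 * K i + 1) := by
  classical
  have : T ⊆ Fintype.piFinset fun i => Finset.Icc (-(K i : ℤ)) (K i) := by
    intro y hy
    rw [Fintype.mem_piFinset]
    intro i
    rw [Finset.mem_Icc, ← abs_le]
    exact hT y hy i
  refine (Finset.card_le_card this).trans (le_of_eq ?_)
  rw [Fintype.card_piFinset]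
  refine Finset.prod_congr rfl fun i _ => ?_
  rw [Int.card_Icc]
  omega

lemma card_carrier (Q : SymGAP) (hQ : Q.Proper) :
    Nat.card Q.carrier = ∏ i, (2 * Q.K i + 1) := by
  classical
  have hbox : Q.box = ((Fintype.piFinset fun i => Finset.Icc (-(Q.K i : ℤ)) (Q.K i) :
      Finset (Fin Q.rank → ℤ)) : Set (Fin Q.rank → ℤ)) := by
    ext y
    simp [SymGAP.box, abs_le, Pi.le_def, forall_and]
  have h1 : Nat.card Q.carrier = Nat.card Q.box := by
    unfold SymGAP.carrier
    exact Nat.card_image_of_injOn hQ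
  rw [h1, hbox, Nat.card_coe_set_eq, Set.ncard_coe_finset, Fintype.card_piFinset]
  refine Finset.prod_congr rfl fun i _ => ?_
  rw [Int.card_Icc]
  omega

lemma Φ_sum (Q : SymGAP) {d : ℕ} (k : Fin d → ℤ) (b : Fin d → (Fin Q.rank → ℤ)) :
    Q.Φ (∑ j, k j • b j) = ∑ j, (k j : ℝ) * Q.Φ (b j) := by
  unfold SymGAP.Φ
  simp only [Finset.sum_apply, Pi.smul_apply, smul_eq_mul, Int.cast_sum, Int.cast_mul,
    Finset.sum_mul, Finset.mul_sum]
  rw [Finset.sum_comm]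
  refine Finset.sum_congr rfl fun i _ => Finset.sum_congr rfl fun j _ => by ring

/-- From an integer relation `m` inside the doubled box, pass to lower rank. -/
lemma step_relation (r : ℕ) : ∃ D : ℝ, 1 ≤ D ∧
    ∀ (g : Fin (r + 1) → ℝ) (K : Fin (r + 1) → ℕ), (∀ i, 1 ≤ K i) →
    ∀ m : Fin (r + 1) → ℤ, m ≠ 0 → (∀ i, |m i| ≤ 2 * (K i : ℤ)) →
    (SymGAP.mk (r + 1) g K).Φ m = 0 →
    ∃ d ≤ r, ∃ g' : Fin d → ℝ, ∃ K' : Fin d → ℕ, (∀ i, 1 ≤ K' i) ∧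
      (SymGAP.mk (r + 1) g K).carrier ⊆ (SymGAP.mk d g' K').carrier ∧
      ∏ i, (2 * (K' i : ℝ) + 1) ≤ D * ∏ i, (2 * (K i : ℝ) + 1) := by
  classical
  obtain ⟨D, hD, H⟩ := lattice_lemma r
  refine ⟨D * 3 ^ (r + 1), one_le_mul_of_one_le_of_one_le hD (one_le_pow₀ (by norm_num)), ?_⟩
  intro g K hK m hm0 hm hΦ
  have hK' : ∀ i, (0 : ℝ) < K i := fun i => by exact_mod_cast hK i
  obtain ⟨i0, -, hi0⟩ := Finset.exists_max_image Finset.univ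
    (fun i => |(m i : ℝ)| / K i) ⟨0, Finset.mem_univ _⟩
  have hmi : ∀ i, |(m i : ℝ)| * K i0 ≤ |(m i0 : ℝ)| * K i := by
    intro i
    have := hi0 i (Finset.mem_univ i)
    rwa [div_le_div_iff₀ (hK' i) (hK' i0)] at this
  have hmi0 : m i0 ≠ 0 := by
    intro h
    apply hm0
    funext i
    have h1 := hmi i
    rw [h] at h1
    simp only [Int.cast_zero, abs_zero, zero_mul] at h1
    have h2 : |(m i : ℝ)| = 0 := by
      by_contra hne
      have : 0 < |(m i : ℝ)| := lt_of_le_of_ne (abs_nonneg _) (Ne.symm hne)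
      have := mul_pos this (hK' i0)
      linarith
    have := abs_eq_zero.1 h2
    exact_mod_cast this
  have hμ : 0 < |(m i0 : ℝ)| := abs_pos.2 (by exact_mod_cast hmi0)
  let L : (Fin (r + 1) → ℤ) →ₗ[ℤ] (Fin (r + 1) → ℤ) :=
    { toFun := fun x => m i0 • x - x i0 • m
      map_add' := by
        intro x y
        funext i
        simp only [Pi.sub_apply, Pi.smul_apply, Pi.add_apply, smul_eq_mul]
        ring
      map_smul' := by
        intro k x
        funext i
        simp only [Pi.sub_apply, Pi.smul_apply, smul_eq_mul, RingHom.id_apply]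
        ring }
  have hL : ∀ x i, L x i = m i0 * x i - x i0 * m i := fun x i => rfl
  obtain ⟨d, hd, b, K', hK1, hcov, hprod⟩ := H K hK (LinearMap.range L) i0
    (by
      rintro _ ⟨x, rfl⟩ h
      funext i
      by_cases hi : i = i0
      · subst hi
        rw [hL]
        simp [mul_comm]
      · exact h i hi)
    |(m i0 : ℝ)| hμ (∏ i, (2 * (3 * K i) + 1)) (by
      intro T hT
      have : ∀ y ∈ T, ∃ x, L x = y ∧ ∀ i, |x i| ≤ ((3 * K i : ℕ) : ℤ) := by
        intro y hy
        obtain ⟨⟨x, rfl⟩, hyb⟩ := hT y hy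
        let t := x i0 / m i0
        have e : ∀ i, L (x - t • m) i = L x i := by
          intro i
          rw [hL, hL]
          simp only [Pi.sub_apply, Pi.smul_apply, smul_eq_mul]
          ring
        refine ⟨x - t • m, funext e, ?_⟩
        have hz0 : (x - t • m) i0 = x i0 % m i0 := by
          simp only [Pi.sub_apply, Pi.smul_apply, smul_eq_mul]
          have := Int.emod_add_mul_ediv (x i0) (m i0)
          simp only [t]
          linarith
        generalize hz : x - t • m = z at *
        have hz1 : |(z i0 : ℝ)| ≤ |(m i0 : ℝ)| := by
          have h1 := Int.emod_nonneg (x i0) hmi0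
          have h2 := Int.emod_lt_abs (x i0) hmi0
          have : |z i0| ≤ |m i0| := by
            rw [hz0, abs_of_nonneg h1]; exact h2.le
          exact_mod_cast this
        intro i
        have h3 := hyb i
        rw [← e i, hL] at h3
        push_cast at h3
        have h4 : |(m i0 : ℝ) * z i| ≤ |(m i0 : ℝ)| * K i + |(z i0 : ℝ) * m i| := by
          have := abs_sub_abs_le_abs_sub ((m i0 : ℝ) * z i) ((z i0 : ℝ) * m i)
          linarith
        rw [abs_mul, abs_mul] at h4
        have h5 : |(m i : ℝ)| ≤ 2 * K i := by exact_mod_cast hm i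
        have h6 : |(z i0 : ℝ)| * |(m i : ℝ)| ≤ |(m i0 : ℝ)| * (2 * K i) :=
          mul_le_mul hz1 h5 (abs_nonneg _) (abs_nonneg _)
        have h7 : |(z i : ℝ)| ≤ 3 * K i := by
          refine le_of_mul_le_mul_left ?_ hμ
          linarith
        exact_mod_cast h7
      choose! x hx hxb using this
      have hinj : Set.InjOn x T := by
        intro y hy y' hy' h
        rw [← hx y hy, ← hx y' hy', h]
      rw [← Finset.card_image_of_injOn hinj]
      refine (card_box_le (fun i => 3 * K i) _ ?_)
      intro z hz
      obtain ⟨y, hy, rfl⟩ := Finset.mem_image.1 hz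
      exact hxb y hy)
  refine ⟨d, hd, fun j => (SymGAP.mk (r + 1) g K).Φ (b j) / m i0, K', hK1, ?_, ?_⟩
  · rintro _ ⟨x, hx, rfl⟩
    have hx' : ∀ i, |(x i : ℝ)| ≤ K i := fun i => by exact_mod_cast hx i
    obtain ⟨k, hk, e⟩ := hcov (L x) ⟨x, rfl⟩ (by
      intro i
      rw [hL]
      push_cast
      have h1 := abs_sub ((m i0 : ℝ) * x i) ((x i0 : ℝ) * m i)
      rw [abs_mul, abs_mul] at h1
      have h2 := mul_le_mul_of_nonneg_left (hx' i) hμ.le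
      have h3 := mul_le_mul_of_nonneg_right (hx' i0) (abs_nonneg (m i : ℝ))
      have h4 := hmi i
      linarith)
    refine ⟨k, hk, ?_⟩
    have h1 := Φ_sum (SymGAP.mk (r + 1) g K) k b
    have h2 : (SymGAP.mk (r + 1) g K).Φ (L x) = m i0 * (SymGAP.mk (r + 1) g K).Φ x := by
      have : (SymGAP.mk (r + 1) g K).Φ (L x) = m i0 * (SymGAP.mk (r + 1) g K).Φ x -
          x i0 * (SymGAP.mk (r + 1) g K).Φ m := by
        unfold SymGAP.Φ
        rw [Finset.mul_sum, Finset.mul_sum, ← Finset.sum_sub_distrib]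
        refine Finset.sum_congr rfl fun i _ => ?_
        rw [hL]
        push_cast
        ring
      rw [this, hΦ, mul_zero, sub_zero]
    have h3 : (m i0 : ℝ) ≠ 0 := by exact_mod_cast hmi0
    show ∑ j, (k j : ℝ) * ((SymGAP.mk (r + 1) g K).Φ (b j) / m i0) = _
    simp only [← mul_div_assoc]
    rw [← Finset.sum_div, div_eq_iff h3, ← h1, mul_comm _ (m i0 : ℝ), ← h2]
    exact congrArg _ e.symm
  · refine hprod.trans ?_
    rw [mul_assoc]
    refine mul_le_mul_of_nonneg_left ?_ (by linarith)
    push_cast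
    have : (3 : ℝ) ^ (r + 1) = ∏ i : Fin (r + 1), (3 : ℝ) := by simp
    rw [this, ← Finset.prod_mul_distrib]
    refine Finset.prod_le_prod (fun i _ => by positivity) fun i _ => ?_
    linarith

/-- If the coordinates of `U` do not span, pass to lower rank. -/
lemma step_span (r : ℕ) : ∃ D : ℝ, 1 ≤ D ∧
    ∀ (g : Fin (r + 1) → ℝ) (K : Fin (r + 1) → ℕ), (∀ i, 1 ≤ K i) →
    ∀ (U : Finset ℝ) (φ : ℝ → (Fin (r + 1) → ℤ)),
    (∀ u ∈ U, φ u ∈ (SymGAP.mk (r + 1) g K).box ∧ u = (SymGAP.mk (r + 1) g K).Φ (φ u)) →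
    Submodule.span ℝ ((fun u => fun i => ((φ u i : ℤ) : ℝ)) '' (U : Set ℝ)) ≠ ⊤ →
    ∃ d ≤ r, ∃ g' : Fin d → ℝ, ∃ K' : Fin d → ℕ, (∀ i, 1 ≤ K' i) ∧
      (U : Set ℝ) ⊆ (SymGAP.mk d g' K').carrier ∧
      ∏ i, (2 * (K' i : ℝ) + 1) ≤ D * ∏ i, (2 * (K i : ℝ) + 1) := by
  classical
  obtain ⟨D, hD, H⟩ := lattice_lemma r
  refine ⟨D, hD, ?_⟩
  intro g K hK U φ hφ hspan
  obtain ⟨f, hf0, hf⟩ := Submodule.exists_le_ker_of_lt_top _ (lt_top_iff_ne_top.2 hspan)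
  obtain ⟨i0, hi0⟩ : ∃ i0, f (Pi.single i0 1) ≠ 0 := by
    by_contra h
    push Not at h
    apply hf0
    apply LinearMap.pi_ext'
    intro i
    ext
    simpa using h i
  let Λ : Submodule ℤ (Fin (r + 1) → ℤ) :=
    { carrier := {x | f (fun i => (x i : ℝ)) = 0}
      zero_mem' := by
        show f _ = 0
        have : (fun i => (((0 : Fin (r + 1) → ℤ) i : ℤ) : ℝ)) = 0 := by funext i; simp
        rw [this, map_zero]
      add_mem' := by
        intro x y hx hy
        show f _ = 0
        have : (fun i => (((x + y) i : ℤ) : ℝ)) = (fun i => (x i : ℝ)) + (fun i => (y i : ℝ)) := by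
          funext i; simp
        rw [this, map_add]
        rw [show f (fun i => (x i : ℝ)) = 0 from hx, show f (fun i => (y i : ℝ)) = 0 from hy,
          add_zero]
      smul_mem' := by
        intro k x hx
        show f _ = 0
        have : (fun i => (((k • x) i : ℤ) : ℝ)) = (k : ℝ) • (fun i => (x i : ℝ)) := by
          funext i; simp
        rw [this, map_smul, show f (fun i => (x i : ℝ)) = 0 from hx, smul_zero] }
  obtain ⟨d, hd, b, K', hK1, hcov, hprod⟩ := H K hK Λ i0
    (by
      intro x hx h
      have h1 : f (fun i => (x i : ℝ)) = 0 := hx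
      have h2 : (fun i => (x i : ℝ)) = (x i0 : ℝ) • (Pi.single i0 1 : Fin (r + 1) → ℝ) := by
        funext i
        by_cases hi : i = i0
        · subst hi; simp
        · simp [hi, h i hi]
      rw [h2, map_smul, smul_eq_mul] at h1
      have h3 : (x i0 : ℝ) = 0 := (mul_eq_zero.1 h1).resolve_right hi0
      funext i
      by_cases hi : i = i0
      · subst hi; exact_mod_cast h3
      · exact h i hi)
    1 one_pos (∏ i, (2 * K i + 1)) (by
      intro T hT
      refine card_box_le K T fun y hy i => ?_
      have := (hT y hy).2 i
      rw [one_mul] at this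
      exact_mod_cast this)
  refine ⟨d, hd, fun j => (SymGAP.mk (r + 1) g K).Φ (b j), K', hK1, ?_, ?_⟩
  · intro u hu
    obtain ⟨hub, hue⟩ := hφ u hu
    obtain ⟨k, hk, e⟩ := hcov (φ u)
      (hf (Submodule.subset_span ⟨u, hu, rfl⟩)) (by
        intro i
        have h1 : |(φ u i : ℝ)| ≤ K i := by exact_mod_cast hub i
        have : (0 : ℝ) ≤ K i := Nat.cast_nonneg _
        linarith)
    refine ⟨k, hk, ?_⟩
    rw [hue]
    refine Eq.trans ?_ (congrArg _ e.symm)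
    exact (Φ_sum (SymGAP.mk (r + 1) g K) k b).symm
  · push_cast at hprod
    exact hprod

lemma main_claim (r : ℕ) : ∃ C : ℝ, 1 ≤ C ∧ ∀ n ≤ r,
    ∀ (g : Fin n → ℝ) (K : Fin n → ℕ), (∀ i, 1 ≤ K i) →
    ∀ (U : Finset ℝ), (U : Set ℝ) ⊆ (SymGAP.mk n g K).carrier →
    ∃ Q : SymGAP, Q.Proper ∧ Q.rank ≤ n ∧
      (U : Set ℝ) ⊆ Q.carrier ∧
      ∏ i, (2 * (Q.K i : ℝ) + 1) ≤ C * ∏ i, (2 * (K i : ℝ) + 1) ∧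
      ∃ φ : ℝ → (Fin Q.rank → ℤ),
        (∀ u ∈ U, φ u ∈ Q.box ∧ u = Q.Φ (φ u)) ∧
        Submodule.span ℝ ((fun u => fun i => ((φ u i : ℤ) : ℝ)) '' (U : Set ℝ)) = ⊤ := by
  classical
  induction r with
  | zero =>
    refine ⟨1, le_rfl, ?_⟩
    intro n hn g K hK U hU
    obtain rfl : n = 0 := by omega
    refine ⟨SymGAP.mk 0 g K, ?_, le_rfl, hU, by simp, fun _ => 0, ?_, ?_⟩
    · intro x _ y _ _
      funext i
      exact i.elim0
    · intro u hu
      obtain ⟨x, hx, hxu⟩ := hU hu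
      refine ⟨fun i => i.elim0, ?_⟩
      rw [← hxu]
      congr 1
      funext i
      exact i.elim0
    · rw [eq_top_iff]
      intro x _
      have : x = 0 := by
        funext i
        exact i.elim0
      rw [this]
      exact Submodule.zero_mem _
  | succ r ih =>
    obtain ⟨C, hC, ih⟩ := ih
    obtain ⟨D₁, hD₁, H₁⟩ := step_relation r
    obtain ⟨D₂, hD₂, H₂⟩ := step_span r
    have hCC : C ≤ C * (D₁ * D₂) :=
      le_mul_of_one_le_right (by linarith) (one_le_mul_of_one_le_of_one_le hD₁ hD₂)
    refine ⟨C * (D₁ * D₂), hC.trans hCC, ?_⟩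
    intro n hn g K hK U hU
    have hpos : 0 ≤ ∏ i, (2 * (K i : ℝ) + 1) := Finset.prod_nonneg fun i _ => by positivity
    rcases Nat.lt_or_ge n (r + 1) with hlt | hge
    · obtain ⟨Q, h1, h2, h3, h4, h5⟩ := ih n (by omega) g K hK U hU
      exact ⟨Q, h1, h2, h3, h4.trans (mul_le_mul_of_nonneg_right hCC hpos), h5⟩
    obtain rfl : n = r + 1 := by omega
    have hφ : ∀ u ∈ U, ∃ x, x ∈ (SymGAP.mk (r + 1) g K).box ∧
        u = (SymGAP.mk (r + 1) g K).Φ x := by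
      intro u hu
      obtain ⟨x, hx, hxu⟩ := hU hu
      exact ⟨x, hx, hxu.symm⟩
    choose! φ hφ using hφ
    have finish : ∀ D : ℝ, 1 ≤ D → D ≤ D₁ * D₂ → (∃ d ≤ r, ∃ g' : Fin d → ℝ, ∃ K' : Fin d → ℕ,
        (∀ i, 1 ≤ K' i) ∧ (U : Set ℝ) ⊆ (SymGAP.mk d g' K').carrier ∧
        ∏ i, (2 * (K' i : ℝ) + 1) ≤ D * ∏ i, (2 * (K i : ℝ) + 1)) →
        ∃ Q : SymGAP, Q.Proper ∧ Q.rank ≤ r + 1 ∧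
          (U : Set ℝ) ⊆ Q.carrier ∧
          ∏ i, (2 * (Q.K i : ℝ) + 1) ≤ C * (D₁ * D₂) * ∏ i, (2 * (K i : ℝ) + 1) ∧
          ∃ φ : ℝ → (Fin Q.rank → ℤ),
            (∀ u ∈ U, φ u ∈ Q.box ∧ u = Q.Φ (φ u)) ∧
            Submodule.span ℝ ((fun u => fun i => ((φ u i : ℤ) : ℝ)) '' (U : Set ℝ)) = ⊤ := by
      rintro D hD1 hD ⟨d, hd, g', K', hK', hU', hp⟩
      obtain ⟨Q, h1, h2, h3, h4, h5⟩ := ih d hd g' K' hK' U hU'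
      refine ⟨Q, h1, by omega, h3, h4.trans ?_, h5⟩
      rw [mul_assoc]
      refine mul_le_mul_of_nonneg_left ?_ (by linarith)
      exact hp.trans (mul_le_mul_of_nonneg_right hD hpos)
    by_cases hprop : (SymGAP.mk (r + 1) g K).Proper
    · by_cases hspan : Submodule.span ℝ
          ((fun u => fun i => ((φ u i : ℤ) : ℝ)) '' (U : Set ℝ)) = ⊤
      · refine ⟨SymGAP.mk (r + 1) g K, hprop, le_rfl, hU, ?_, φ, hφ, hspan⟩
        exact le_mul_of_one_le_left hpos (hC.trans hCC)
      · exact finish D₂ hD₂ (le_mul_of_one_le_left (by linarith) hD₁) (H₂ g K hK U φ hφ hspan)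
    · refine finish D₁ hD₁ (le_mul_of_one_le_right (by linarith) hD₂) ?_
      unfold SymGAP.Proper Set.InjOn at hprop
      push Not at hprop
      obtain ⟨x, hx, y, hy, hxy, hne⟩ := hprop
      obtain ⟨d, hd, g', K', h1, h2, h3⟩ := H₁ g K hK (x - y) (sub_ne_zero.2 hne)
        (by
          intro i
          have h1 : |x i| ≤ (K i : ℤ) := hx i
          have h2 : |y i| ≤ (K i : ℤ) := hy i
          have h3 := abs_sub (x i) (y i)
          simp only [Pi.sub_apply]
          linarith)
        (by
          have : (SymGAP.mk (r + 1) g K).Φ (x - y) =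
              (SymGAP.mk (r + 1) g K).Φ x - (SymGAP.mk (r + 1) g K).Φ y := by
            unfold SymGAP.Φ
            rw [← Finset.sum_sub_distrib]
            refine Finset.sum_congr rfl fun i _ => ?_
            rw [Pi.sub_apply]
            push_cast
            ring
          rw [this, hxy, sub_self])
      exact ⟨d, hd, g', K', h1, hU.trans h2, h3⟩

/-- Full rank containment: if a finite set `U ⊆ ℝ` is contained in a proper symmetric GAP
`P` of rank `r`, then there is a proper symmetric GAP `Q ⊇ U` of rank at most `r`, of
cardinality at most `O_r(1) · |P|`, such that the coordinate vectors of `U` in `Q` span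
`ℝ^{rank Q}`. -/
theorem exists_spanning_proper_gap (r : ℕ) :
    ∃ C : ℝ, 0 < C ∧
      ∀ (P : SymGAP), P.rank = r → P.Proper →
        ∀ U : Finset ℝ, (U : Set ℝ) ⊆ P.carrier →
          ∃ Q : SymGAP, Q.Proper ∧ Q.rank ≤ r ∧
            (U : Set ℝ) ⊆ Q.carrier ∧
            (Nat.card Q.carrier : ℝ) ≤ C * (Nat.card P.carrier : ℝ) ∧
            ∃ φ : ℝ → (Fin Q.rank → ℤ),
              (∀ u ∈ U, φ u ∈ Q.box ∧ u = Q.Φ (φ u)) ∧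
              Submodule.span ℝ ((fun u => fun i => ((φ u i : ℤ) : ℝ)) '' (U : Set ℝ)) = ⊤ := by
  obtain ⟨C, hC, H⟩ := main_claim r
  refine ⟨C * 3 ^ r, by positivity, ?_⟩
  intro P hr hP U hU
  subst hr
  obtain ⟨Q, h1, h2, h3, h4, h5⟩ := H P.rank le_rfl P.g (fun i => max (P.K i) 1)
    (fun i => le_max_right _ _) U (by
      intro u hu
      obtain ⟨x, hx, hxu⟩ := hU hu
      refine ⟨x, fun i => (hx i).trans ?_, hxu⟩
      show ((P.K i : ℕ) : ℤ) ≤ ((max (P.K i) 1 : ℕ) : ℤ)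
      exact_mod_cast le_max_left _ _)
  refine ⟨Q, h1, h2, h3, ?_, h5⟩
  rw [card_carrier Q h1, card_carrier P hP]
  push_cast at h4 ⊢
  refine h4.trans ?_
  rw [mul_assoc]
  refine mul_le_mul_of_nonneg_left ?_ (by linarith)
  have : (3 : ℝ) ^ P.rank = ∏ i : Fin P.rank, (3 : ℝ) := by simp
  rw [this, ← Finset.prod_mul_distrib]
  refine Finset.prod_le_prod (fun i _ => by positivity) fun i _ => ?_
  have h6 : (0 : ℝ) ≤ P.K i := Nat.cast_nonneg _
  have h7 : max (P.K i : ℝ) 1 ≤ P.K i + 1 := max_le (by linarith) (by linarith)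
  linarith
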